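/- Let d ≥ 1 be an integer, θ ∈ [0,1), k ∈ [0,(1−θ²)/d), and a ∈ [0, 1−θ²−k·d). Then I(θ,k,a) > 0. -/

import Mathlib

open Real in
/-- The large-deviation rate function `I(θ,k,a) = inf_{ρ ∈ (0,ρ̄]} f_{θ,k,a}(ρ)`, where
`γ = a + k·d`, `ρ̄ = 1 − γ/2 − √((γ/2)² + θ²)` and
`f_{θ,k,a}(ρ) = ρ + (√((1−ρ)² − γ(1−ρ)) − θ)²/ρ`. -/
noncomputable def rateI (d : ℕ) (θ k a : ℝ) : ℝ :=
  sInf ((fun ρ : ℝ => ρ + (Real.sqrt ((1 - ρ) ^ 2 - (a + k * d) * (1 - ρ)) - θ) ^ 2 / ρ) ''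
    Set.Ioc (0 : ℝ) (1 - (a + k * d) / 2 - Real.sqrt (((a + k * d) / 2) ^ 2 + θ ^ 2)))

/-- Strict positivity of the rate function `I(θ,k,a)` on the admissible parameter range. -/
theorem rateI_pos (d : ℕ) (hd : 1 ≤ d) (θ k a : ℝ)
    (hθ0 : 0 ≤ θ) (hθ1 : θ < 1)
    (hk0 : 0 ≤ k) (hk1 : k < (1 - θ ^ 2) / d)
    (ha0 : 0 ≤ a) (ha1 : a < 1 - θ ^ 2 - k * d) :
    0 < rateI d θ k a := by
  have hγ0 : 0 ≤ a + k * d := by positivity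
  unfold rateI
  generalize hg : a + k * (d : ℝ) = γ at *
  have hδ : 0 < 1 - γ - θ ^ 2 := by linarith
  have hne : 0 < 1 - γ / 2 - Real.sqrt ((γ / 2) ^ 2 + θ ^ 2) := by
    have : Real.sqrt ((γ / 2) ^ 2 + θ ^ 2) < 1 - γ / 2 := by
      rw [Real.sqrt_lt' (by nlinarith [sq_nonneg θ])]
      nlinarith
    linarith
  have hb : 0 < (1 - γ - θ ^ 2) / 4 := by linarith
  refine lt_of_lt_of_le hb (le_csInf ((Set.nonempty_Ioc.2 hne).image _) ?_)
  rintro _ ⟨ρ, ⟨hρ0, -⟩, rfl⟩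
  dsimp only
  by_cases h : (1 - γ - θ ^ 2) / 4 ≤ ρ
  · have : 0 ≤ (Real.sqrt ((1 - ρ) ^ 2 - γ * (1 - ρ)) - θ) ^ 2 / ρ := by positivity
    linarith
  · push Not at h
    have hs : θ + (1 - γ - θ ^ 2) / 4 ≤ Real.sqrt ((1 - ρ) ^ 2 - γ * (1 - ρ)) := by
      apply Real.le_sqrt_of_sq_le
      have h1 : θ + (1 - γ - θ ^ 2) / 8 ≤ 1 := by nlinarith
      have h2 := mul_le_mul_of_nonneg_left h1 hδ.le
      have h3 := mul_nonneg hγ0 hρ0.le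
      nlinarith [sq_nonneg ρ]
    have h4 : (1 - γ - θ ^ 2) / 4 ≤ (Real.sqrt ((1 - ρ) ^ 2 - γ * (1 - ρ)) - θ) ^ 2 / ρ := by
      rw [le_div_iff₀ hρ0]
      have h5 : (1 - γ - θ ^ 2) / 4 ≤ Real.sqrt ((1 - ρ) ^ 2 - γ * (1 - ρ)) - θ := by linarith
      have h6 := pow_le_pow_left₀ hb.le h5 2
      have h7 := mul_le_mul_of_nonneg_left h.le hb.le
      nlinarith
    linarith
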